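/- For every matrix A ∈ M_n(𝕋) with n ≥ 2 and all indices i ≠ j, the off-diagonal entry (A ⊙ Adj(A))_{ij} = ⊕_k a_{ik} ⊙ |A_{jk}| lies in ℝ̄^ν (it is a ghost element or −∞). -/

import Mathlib

/-- The extended tropical semiring `𝕋 = ℝ ∪ {−∞} ∪ ℝ^ν`:
`neginf` is `−∞`, `real a` is the real (tangible) element `a`,
and `ghost a` is the ghost element `a^ν`. -/
inductive T : Type where
  | neginf : T
  | real : ℝ → T
  | ghost : ℝ → T

namespace T

/-- Tropical addition `⊕` on `𝕋`. -/
noncomputable def add : T → T → T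
  | neginf, x => x
  | real a, neginf => real a
  | ghost a, neginf => ghost a
  | real a, real b => if a < b then real b else if b < a then real a else ghost a
  | real a, ghost b => if a ≤ b then ghost b else real a
  | ghost a, real b => if b ≤ a then ghost a else real b
  | ghost a, ghost b => if a < b then ghost b else ghost a

/-- Tropical multiplication `⊙` on `𝕋`. -/
noncomputable def mul : T → T → T
  | neginf, _ => neginf
  | real _, neginf => neginf
  | ghost _, neginf => neginf
  | real a, real b => real (a + b)
  | real a, ghost b => ghost (a + b)
  | ghost a, real b => ghost (a + b)
  | ghost a, ghost b => ghost (a + b)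

/-- The strict order `≺` on `𝕋`. -/
def lt : T → T → Prop
  | neginf, neginf => False
  | neginf, real _ => True
  | neginf, ghost _ => True
  | real _, neginf => False
  | ghost _, neginf => False
  | real a, real b => a < b
  | real a, ghost b => a ≤ b
  | ghost a, real b => a < b
  | ghost a, ghost b => a < b

/-- The order `⪯` on `𝕋`: `x ⪯ y` iff `x = y` or `x ≺ y`. -/
def le (x y : T) : Prop := x = y ∨ lt x y

/-- Membership in `ℝ̄^ν = ℝ^ν ∪ {−∞}` (the ghost elements together with `−∞`). -/
def isGhost : T → Prop
  | neginf => True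
  | real _ => False
  | ghost _ => True

/-- Membership in `ℝ` (the real, tangible elements). -/
def isReal : T → Prop
  | neginf => False
  | real _ => True
  | ghost _ => False

/-- The ghost map `ν : 𝕋 → ℝ̄^ν`. -/
def nu : T → T
  | neginf => neginf
  | real a => ghost a
  | ghost a => ghost a

/-- The projection `π : 𝕋 → ℝ ∪ {−∞}` onto the max-plus semiring `(ℝ ∪ {−∞}, max, +)`,
realized as `WithBot ℝ`. -/
def pi : T → WithBot ℝ
  | neginf => ⊥
  | real a => (a : WithBot ℝ)
  | ghost a => (a : WithBot ℝ)

/-- The embedding `θ : (ℝ ∪ {−∞}, max, +) → 𝕋`, `a ↦ a^ν`, `−∞ ↦ −∞`. -/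
def theta : WithBot ℝ → T :=
  fun x => WithBot.recBotCoe neginf (fun a => ghost a) x

/-- `pow x n` is the `n`-fold tropical product `x ⊙ x ⊙ ⋯ ⊙ x` (with `pow x 0 = 0`, the one). -/
noncomputable def pow (x : T) : ℕ → T
  | 0 => real 0
  | n + 1 => mul x (pow x n)

instance : Std.Commutative add := ⟨by
  intro x y
  cases x <;> cases y <;> simp only [add] <;> split_ifs <;>
    first | rfl | (exfalso; linarith) | (congr 1; linarith)⟩

instance : Std.Associative add := ⟨by
  intro x y z
  cases x <;> cases y <;> cases z <;>
    simp only [add] <;>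
    repeat' (first | split_ifs | simp only [add]) 
  all_goals first | rfl | (exfalso; linarith) | (congr 1; linarith)⟩

instance : Std.Commutative mul := ⟨by
  intro x y
  cases x <;> cases y <;> simp only [mul] <;> congr 1 <;> ring⟩

instance : Std.Associative mul := ⟨by
  intro x y z
  cases x <;> cases y <;> cases z <;> simp only [mul] <;> congr 1 <;> ring⟩

/-- Finite tropical sum `⊕` over a finite index set. -/
noncomputable def sumT {ι : Type*} (s : Finset ι) (f : ι → T) : T := s.fold add neginf f

/-- Finite tropical product `⊙` over a finite index set. -/
noncomputable def prodT {ι : Type*} (s : Finset ι) (f : ι → T) : T := s.fold mul (real 0) f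

/-- Tropical matrix multiplication over `𝕋`. -/
noncomputable def matMul {n : ℕ} (A B : Matrix (Fin n) (Fin n) T) : Matrix (Fin n) (Fin n) T :=
  fun i j => sumT Finset.univ fun k => mul (A i k) (B k j)

/-- The tropical determinant (permanent) `|A| = ⊕_{σ ∈ S_n} a_{1σ(1)} ⊙ ⋯ ⊙ a_{nσ(n)}`. -/
noncomputable def det {n : ℕ} (A : Matrix (Fin n) (Fin n) T) : T :=
  sumT Finset.univ fun σ : Equiv.Perm (Fin n) => prodT Finset.univ fun i => A i (σ i)

/-- `A` is tropically regular if `|A| ∈ ℝ`. -/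
def regular {n : ℕ} (A : Matrix (Fin n) (Fin n) T) : Prop := isReal (det A)

/-- `A` is tropically singular if `|A| ∈ ℝ̄^ν`. -/
def singular {n : ℕ} (A : Matrix (Fin n) (Fin n) T) : Prop := isGhost (det A)

/-- The minor `A_{ij}`: delete row `i` and column `j`. -/
noncomputable def minor {n : ℕ} (A : Matrix (Fin (n+1)) (Fin (n+1)) T) (i j : Fin (n+1)) :
    Matrix (Fin n) (Fin n) T :=
  A.submatrix i.succAbove j.succAbove

/-- The adjoint matrix `Adj(A)`, the transpose of the matrix of minors' determinants. -/
noncomputable def adj {n : ℕ} (A : Matrix (Fin (n+1)) (Fin (n+1)) T) :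
    Matrix (Fin (n+1)) (Fin (n+1)) T :=
  fun i j => det (minor A j i)

/-- The `⊙`-inverse `x^{-1}` (only meaningful away from `−∞`): `a ↦ −a`, `a^ν ↦ (−a)^ν`. -/
def dinv : T → T
  | neginf => neginf
  | real a => real (-a)
  | ghost a => ghost (-a)

/-- The pseudo inverse `A^∇ = Adj(A) ⊙ |A|^{-1}`. -/
noncomputable def pinv {n : ℕ} (A : Matrix (Fin (n+1)) (Fin (n+1)) T) :
    Matrix (Fin (n+1)) (Fin (n+1)) T :=
  fun i j => mul (adj A i j) (dinv (det A))

/-- A pseudo unit matrix: tropically regular, `0` on the diagonal,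
and ghosts (or `−∞`) off the diagonal. -/
def pseudoUnit {n : ℕ} (E : Matrix (Fin n) (Fin n) T) : Prop :=
  regular E ∧ (∀ i, E i i = real 0) ∧ ∀ i j, i ≠ j → isGhost (E i j)

/-- `A` is pseudo invertible if `A ⊙ B` and `B ⊙ A` are pseudo units for some `B`. -/
def pseudoInvertible {n : ℕ} (A : Matrix (Fin n) (Fin n) T) : Prop :=
  ∃ B, pseudoUnit (matMul A B) ∧ pseudoUnit (matMul B A)

/-- The ray/point `P_x ⊆ ℝ ∪ {−∞}` assigned to `x ∈ 𝕋`: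
`P_{−∞} = {−∞}`, `P_a = {a}`, `P_{a^ν} = [−∞, a]`. -/
def P : T → Set (WithBot ℝ)
  | neginf => {⊥}
  | real a => {(a : WithBot ℝ)}
  | ghost a => {t | t ≤ (a : WithBot ℝ)}

end T

namespace T

theorem add_mul_distrib (x y z : T) : mul (add x y) z = add (mul x z) (mul y z) := by
  cases x <;> cases y <;> cases z <;> simp only [add, mul] <;>
    repeat' (first | split_ifs | simp only [add, mul])
  all_goals first | rfl | (exfalso; linarith) | (congr 1; linarith)

/-- The extended tropical semiring as a commutative semiring. -/
noncomputable instance : CommSemiring T where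
  add := add
  mul := mul
  zero := neginf
  one := real 0
  nsmul := @nsmulRec T ⟨neginf⟩ ⟨add⟩
  add_assoc := Std.Associative.assoc (op := add)
  add_comm := Std.Commutative.comm (op := add)
  zero_add _ := rfl
  add_zero x := by cases x <;> rfl
  mul_assoc := Std.Associative.assoc (op := mul)
  mul_comm := Std.Commutative.comm (op := mul)
  zero_mul _ := rfl
  mul_zero x := by cases x <;> rfl
  one_mul x := by cases x <;> first | rfl | exact congrArg _ (zero_add _)
  mul_one x := by cases x <;> first | rfl | exact congrArg _ (add_zero _)
  left_distrib x y z := by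
    have h := add_mul_distrib y z x
    rwa [Std.Commutative.comm (op := mul), Std.Commutative.comm (op := mul) y,
      Std.Commutative.comm (op := mul) z] at h
  right_distrib := add_mul_distrib

theorem sumT_eq_sum {ι : Type*} (s : Finset ι) (f : ι → T) : sumT s f = ∑ i ∈ s, f i := by
  classical
  induction s using Finset.induction_on with
  | empty => rfl
  | insert a s ha ih =>
    rw [Finset.sum_insert ha, ← ih]
    exact Finset.fold_insert ha

theorem prodT_eq_prod {ι : Type*} (s : Finset ι) (f : ι → T) : prodT s f = ∏ i ∈ s, f i := by
  classical
  induction s using Finset.induction_on with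
  | empty => rfl
  | insert a s ha ih =>
    rw [Finset.prod_insert ha, ← ih]
    exact Finset.fold_insert ha

theorem isGhost_add_self (x : T) : isGhost (x + x) := by
  change isGhost (add x x)
  cases x <;> simp [add, isGhost]

end T

open Equiv in
/-- Extend a bijection of `Fin n` to one of `Fin (n+1)` sending `j` to `k`. -/
def extendPerm {n : ℕ} (j : Fin (n+1)) (p : Fin (n+1) × Perm (Fin n)) : Perm (Fin (n+1)) :=
  (finSuccEquiv' j).trans ((optionCongr p.2).trans (finSuccEquiv' p.1).symm)

theorem extendPerm_self {n : ℕ} (j : Fin (n+1)) (p : Fin (n+1) × Equiv.Perm (Fin n)) :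
    extendPerm j p j = p.1 := by
  simp [extendPerm]

theorem extendPerm_succAbove {n : ℕ} (j : Fin (n+1)) (p : Fin (n+1) × Equiv.Perm (Fin n))
    (m : Fin n) : extendPerm j p (j.succAbove m) = p.1.succAbove (p.2 m) := by
  simp [extendPerm]

theorem extendPerm_bijective {n : ℕ} (j : Fin (n+1)) :
    Function.Bijective (extendPerm j) := by
  rw [Fintype.bijective_iff_injective_and_card]
  refine ⟨?_, by simp [Fintype.card_perm, Nat.factorial_succ]⟩
  rintro ⟨k, τ⟩ ⟨k', τ'⟩ h
  obtain rfl : k = k' := by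
    simpa only [extendPerm_self] using congrArg (fun σ => σ j) h
  refine Prod.ext rfl (Equiv.ext fun m => ?_)
  have hm := congrArg (fun σ => σ (j.succAbove m)) h
  simpa only [extendPerm_succAbove, Fin.succAbove_right_inj] using hm

/-- Laplace expansion of the permanent along row `j`. -/
theorem sum_mul_sum_perm_succAbove {R : Type*} [CommSemiring R] {n : ℕ}
    (B : Matrix (Fin (n+1)) (Fin (n+1)) R) (j : Fin (n+1)) :
    ∑ k, B j k * ∑ τ : Equiv.Perm (Fin n), ∏ m, B (j.succAbove m) (k.succAbove (τ m)) =
      ∑ σ : Equiv.Perm (Fin (n+1)), ∏ m, B m (σ m) := by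
  simp_rw [Finset.mul_sum]
  rw [← Fintype.sum_prod_type']
  refine Fintype.sum_bijective (extendPerm j) (extendPerm_bijective j) _ _ fun p => ?_
  rw [Fin.prod_univ_succAbove _ j, extendPerm_self]
  simp_rw [extendPerm_succAbove]

/-- The permanent of a matrix with two equal rows is the double of some element. -/
theorem exists_sum_perm_eq_add_self {ι R : Type*} [Fintype ι] [DecidableEq ι] [CommSemiring R]
    (B : Matrix ι ι R) {i j : ι} (hij : i ≠ j) (hB : B i = B j) :
    ∃ x, ∑ σ : Equiv.Perm ι, ∏ m, B m (σ m) = x + x := by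
  have hswap (σ : Equiv.Perm ι) :
      ∏ m, B m ((σ * Equiv.swap i j) m) = ∏ m, B m (σ m) := by
    refine Fintype.prod_equiv (Equiv.swap i j) _ _ fun m => ?_
    have hrow : B (Equiv.swap i j m) = B m := by
      rcases eq_or_ne m i with rfl | hi
      · rw [Equiv.swap_apply_left, hB]
      · rcases eq_or_ne m j with rfl | hj
        · rw [Equiv.swap_apply_right, hB]
        · rw [Equiv.swap_apply_of_ne_of_ne hi hj]
    rw [hrow, Equiv.Perm.mul_apply]
  refine ⟨∑ σ : Equiv.Perm ι with Equiv.Perm.sign σ = 1, ∏ m, B m (σ m), ?_⟩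
  rw [← Finset.sum_filter_add_sum_filter_not Finset.univ (fun σ => Equiv.Perm.sign σ = 1)]
  congr 1
  refine Finset.sum_nbij' (· * Equiv.swap i j) (· * Equiv.swap i j) ?_ ?_ ?_ ?_ ?_
  · intro σ hσ
    have h := (Int.units_eq_one_or (Equiv.Perm.sign σ)).resolve_left (Finset.mem_filter.1 hσ).2
    simp [Equiv.Perm.sign_swap hij, h]
  · intro σ hσ
    have h := (Finset.mem_filter.1 hσ).2
    simp [Equiv.Perm.sign_swap hij, h]
  · intro σ _
    simp
  · intro σ _
    simp
  · intro σ _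
    exact (hswap σ).symm

/-- the off-diagonal entries of `A ⊙ Adj(A)`, namely
`(A ⊙ Adj(A))_{ij} = ⊕_k a_{ik} ⊙ |A_{jk}|` for `i ≠ j`, lie in `ℝ̄^ν`. -/
theorem matMul_adj_offdiagonal {n : ℕ} (A : Matrix (Fin (n+1)) (Fin (n+1)) T)
    (i j : Fin (n+1)) (hij : i ≠ j) :
    T.matMul A (T.adj A) i j
      = T.sumT Finset.univ (fun k => T.mul (A i k) (T.det (T.minor A j k))) ∧
    T.isGhost (T.matMul A (T.adj A) i j) := by
  refine ⟨rfl, ?_⟩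
  obtain ⟨x, hx⟩ := exists_sum_perm_eq_add_self (A.updateRow j (A i)) hij (by
    rw [Matrix.updateRow_self, Matrix.updateRow_ne hij])
  have key : T.matMul A (T.adj A) i j = x + x := by
    rw [← hx, ← sum_mul_sum_perm_succAbove _ j]
    simp only [T.matMul, T.adj, T.det, T.minor, T.sumT_eq_sum, T.prodT_eq_prod,
      Matrix.updateRow_self, Matrix.updateRow_ne (Fin.succAbove_ne j _)]
    rfl
  rw [key]
  exact T.isGhost_add_self x
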